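/- Fix constants 0<c₁<c₂. There is a constant C such that for every N₀>1 and every (τ,ζ)∈ℝ×ℝ×ℤ, the measure (with respect to the product measure (dζ₁)=Lebesgue measure in ξ₁ times counting measure in η₁) of the set {ζ₁∈ℝ×ℤ : c₁N₀≤|ζ₁|≤c₂N₀, c₁N₀≤|ζ−ζ₁|≤c₂N₀, and |τ−|ζ₁|²−|ζ−ζ₁|²|≤1} is at most C; in particular the bound is uniform in N₀, τ and ζ. -/

import Mathlib

open MeasureTheory Complex
open scoped ENNReal Classical

noncomputable section

/-- The torus `ℝ/2πℤ`. -/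
abbrev 𝕋 : Type := AddCircle (2 * Real.pi)

instance : Fact (0 < 2 * Real.pi) := ⟨by positivity⟩

/-- Lebesgue-times-counting measure `(dζ)` on the frequency space `ℝ × ℤ`. -/
def freqMeasure : Measure (ℝ × ℤ) := (volume : Measure ℝ).prod Measure.count

/-- Measure on the spatial domain `ℝ × 𝕋`. -/
def spaceMeasure : Measure (ℝ × 𝕋) := (volume : Measure ℝ).prod volume

/-- Measure on space-time `ℝ × (ℝ × 𝕋)`. -/
def spacetimeMeasure : Measure (ℝ × (ℝ × 𝕋)) := (volume : Measure ℝ).prod spaceMeasure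

/-- `|ζ|` for a frequency `ζ = (ξ, η) ∈ ℝ × ℤ`. -/
def fnorm (ζ : ℝ × ℤ) : ℝ := Real.sqrt (ζ.1 ^ 2 + (ζ.2 : ℝ) ^ 2)

/-- The Japanese bracket `⟨x⟩ = (1 + x²)^{1/2}`. -/
def jap (x : ℝ) : ℝ := Real.sqrt (1 + x ^ 2)

/-- Indicator of a proposition, complex valued. -/
def ind (P : Prop) : ℂ := if P then 1 else 0

/-- Indicator of a proposition, real valued. -/
def indR (P : Prop) : ℝ := if P then 1 else 0

/-- The character `e^{-i z·ζ}` for `z ∈ ℝ × 𝕋`, `ζ ∈ ℝ × ℤ`. -/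
def chr (ζ : ℝ × ℤ) (z : ℝ × 𝕋) : ℂ :=
  Complex.exp (-Complex.I * (z.1 * ζ.1)) * (fourier (-ζ.2) z.2)

/-- The character `e^{i z·ζ}`. -/
def chrInv (ζ : ℝ × ℤ) (z : ℝ × 𝕋) : ℂ :=
  Complex.exp (Complex.I * (z.1 * ζ.1)) * (fourier ζ.2 z.2)

/-- Spatial Fourier transform on `ℝ × 𝕋`. -/
def FT (f : ℝ × 𝕋 → ℂ) (ζ : ℝ × ℤ) : ℂ :=
  (2 * Real.pi)⁻¹ * ∫ z, chr ζ z * f z ∂spaceMeasure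

/-- Fourier transform of the complex conjugate. -/
def FTc (f : ℝ × 𝕋 → ℂ) (ζ : ℝ × ℤ) : ℂ :=
  FT (fun z => (starRingEnd ℂ) (f z)) ζ

/-- Space-time Fourier transform on `ℝ × ℝ × 𝕋`. -/
def STFT (f : ℝ → ℝ × 𝕋 → ℂ) (τ : ℝ) (ζ : ℝ × ℤ) : ℂ :=
  ((2 * Real.pi) ^ (3/2 : ℝ))⁻¹ *
    ∫ t : ℝ, Complex.exp (-Complex.I * (t * τ)) * ∫ z, chr ζ z * f t z ∂spaceMeasure

/-- The Sobolev `H^s(ℝ × 𝕋)` norm. -/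
def HNorm (s : ℝ) (f : ℝ × 𝕋 → ℂ) : ℝ≥0∞ :=
  (∫⁻ ζ, ENNReal.ofReal (jap (fnorm ζ) ^ (2 * s) * ‖FT f ζ‖ ^ 2) ∂freqMeasure) ^ (1/2 : ℝ)

/-- The `X^{s,b}` norm. -/
def XNorm (s b : ℝ) (f : ℝ → ℝ × 𝕋 → ℂ) : ℝ≥0∞ :=
  (∫⁻ p : ℝ × (ℝ × ℤ),
      ENNReal.ofReal (jap (fnorm p.2) ^ (2 * s) * jap (p.1 - fnorm p.2 ^ 2) ^ (2 * b) *
        ‖STFT f p.1 p.2‖ ^ 2)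
    ∂((volume : Measure ℝ).prod freqMeasure)) ^ (1/2 : ℝ)

/-- The restricted `X^{s,b}(I)` norm on a time interval. -/
def XNormOn (s b : ℝ) (S : Set ℝ) (f : ℝ → ℝ × 𝕋 → ℂ) : ℝ≥0∞ :=
  ⨅ (g : ℝ → ℝ × 𝕋 → ℂ) (_ : ∀ t ∈ S, g t = f t), XNorm s b g

/-- `f` has spatial frequencies `N` (annulus `c₁N ≤ |ζ| ≤ c₂N`). -/
def supportedInAnnulus (c₁ c₂ N : ℝ) (f : ℝ × 𝕋 → ℂ) : Prop :=
  ∀ ζ, FT f ζ ≠ 0 → c₁ * N ≤ fnorm ζ ∧ fnorm ζ ≤ c₂ * N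

/-- A space-time function has spatial frequencies `N`. -/
def stSupportedInAnnulus (c₁ c₂ N : ℝ) (f : ℝ → ℝ × 𝕋 → ℂ) : Prop :=
  ∀ τ ζ, STFT f τ ζ ≠ 0 → c₁ * N ≤ fnorm ζ ∧ fnorm ζ ≤ c₂ * N

/-- Cosine of the angle between two frequencies viewed as vectors in `ℝ²`. -/
def cosAngle (a b : ℝ × ℤ) : ℝ :=
  (a.1 * b.1 + (a.2 : ℝ) * (b.2 : ℝ)) / (fnorm a * fnorm b)

/-- The angle of `ζ` viewed as a vector in `ℝ²`. -/
def argOf (ζ : ℝ × ℤ) : ℝ := Complex.arg (ζ.1 + (ζ.2 : ℝ) * Complex.I)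

/-- `arg ζ = α + O(δ)` modulo `2π`. -/
def argNear (α δ : ℝ) (ζ : ℝ × ℤ) : Prop :=
  ∃ k : ℤ, |argOf ζ - α + 2 * Real.pi * k| ≤ δ

/-- Space-time `L^p` norm on `ℝ × ℝ × 𝕋`. -/
def STp (p : ℝ≥0∞) (f : ℝ → ℝ × 𝕋 → ℂ) : ℝ≥0∞ :=
  eLpNorm (fun q : ℝ × (ℝ × 𝕋) => f q.1 q.2) p spacetimeMeasure

/-- Spatial `L²` norm. -/
def L2space (φ : ℝ × 𝕋 → ℂ) : ℝ≥0∞ := eLpNorm φ 2 spaceMeasure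

/-- Partial derivative in the `x` (real line) direction. -/
def dX (f : ℝ × 𝕋 → ℂ) (z : ℝ × 𝕋) : ℂ := deriv (fun x => f (x, z.2)) z.1

/-- Partial derivative in the `y` (torus) direction. -/
def dY (f : ℝ × 𝕋 → ℂ) (z : ℝ × 𝕋) : ℂ := deriv (fun s : ℝ => f (z.1, z.2 + (s : 𝕋))) 0

/-- The Laplacian on `ℝ × 𝕋`. -/
def lap (f : ℝ × 𝕋 → ℂ) (z : ℝ × 𝕋) : ℂ := dX (dX f) z + dY (dY f) z

/-- `u` solves the cubic defocusing NLS `i ∂_t u + Δ u = |u|² u` at all times in `S`. -/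
def IsNLSOn (u : ℝ → ℝ × 𝕋 → ℂ) (S : Set ℝ) : Prop :=
  ∀ t ∈ S, ∀ z, Complex.I * deriv (fun t' => u t' z) t + lap (u t) z
    = ((‖u t z‖ ^ 2 : ℝ) : ℂ) * u t z

/-- The free Schrödinger evolution `e^{itΔ}φ` on `ℝ × 𝕋`. -/
def evol (φ : ℝ × 𝕋 → ℂ) (t : ℝ) (z : ℝ × 𝕋) : ℂ :=
  (2 * Real.pi)⁻¹ *
    ∫ ζ, Complex.exp (-Complex.I * (t * fnorm ζ ^ 2)) * chrInv ζ z * FT φ ζ ∂freqMeasure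

/-- The `I`-operator: Fourier multiplier with symbol `m₀(|ζ|)`. -/
def Iop (m₀ : ℝ → ℝ) (f : ℝ × 𝕋 → ℂ) (z : ℝ × 𝕋) : ℂ :=
  (2 * Real.pi)⁻¹ * ∫ ζ, chrInv ζ z * ((m₀ (fnorm ζ) : ℝ) : ℂ) * FT f ζ ∂freqMeasure

/-- `m₀` is (the radial profile of) the I-method multiplier of parameters `s`, `N`. -/
structure IsIMultiplier (s N : ℝ) (m₀ : ℝ → ℝ) : Prop where
  pos : ∀ r, 0 < m₀ r
  smooth : ∀ n : ℕ, ContDiff ℝ n m₀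
  mono : MonotoneOn m₀ (Set.Ici 0)
  low : ∀ r, 0 ≤ r → r < N → m₀ r = 1
  high : ∀ r, 2 * N < r → m₀ r = (r / N) ^ (s - 1)
  incr : MonotoneOn (fun r => (m₀ r) ^ 2 * r ^ 2) (Set.Ici 0)

/-- `m(ζ) = m₀(|ζ|)`. -/
def mζ (m₀ : ℝ → ℝ) (ζ : ℝ × ℤ) : ℝ := m₀ (fnorm ζ)

/-- `m(ζ₁)²|ζ₁|² − m(ζ₂)²|ζ₂|² + m(ζ₃)²|ζ₃|² − m(ζ₄)²|ζ₄|²`. -/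
def quadSym (m₀ : ℝ → ℝ) (ζ₁ ζ₂ ζ₃ ζ₄ : ℝ × ℤ) : ℝ :=
  mζ m₀ ζ₁ ^ 2 * fnorm ζ₁ ^ 2 - mζ m₀ ζ₂ ^ 2 * fnorm ζ₂ ^ 2
    + mζ m₀ ζ₃ ^ 2 * fnorm ζ₃ ^ 2 - mζ m₀ ζ₄ ^ 2 * fnorm ζ₄ ^ 2

/-- `θ₀ = (1 + |ζ₁| + |ζ₂| + |ζ₃| + |ζ₄|)⁻¹`. -/
def theta0 (ζ₁ ζ₂ ζ₃ ζ₄ : ℝ × ℤ) : ℝ :=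
  (1 + fnorm ζ₁ + fnorm ζ₂ + fnorm ζ₃ + fnorm ζ₄)⁻¹

/-- The multiplier `Λ₄` of the modified energy; `κ` is the implicit constant in `max|ζ_j| ≪ N`. -/
def Lam4 (m₀ : ℝ → ℝ) (N κ : ℝ) (ζ₁ ζ₂ ζ₃ ζ₄ : ℝ × ℤ) : ℝ :=
  (quadSym m₀ ζ₁ ζ₂ ζ₃ ζ₄ /
      (fnorm ζ₁ ^ 2 - fnorm ζ₂ ^ 2 + fnorm ζ₃ ^ 2 - fnorm ζ₄ ^ 2)) *
    indR (theta0 ζ₁ ζ₂ ζ₃ ζ₄ < |cosAngle (ζ₁ + ζ₂) (ζ₁ + ζ₄)|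
      ∨ max (max (fnorm ζ₁) (fnorm ζ₂)) (max (fnorm ζ₃) (fnorm ζ₄)) < κ * N)

/-- The modified energy `E_I`. -/
def EI (m₀ : ℝ → ℝ) (N κ : ℝ) (f : ℝ × 𝕋 → ℂ) : ℂ :=
  (1/2 : ℂ) * (∫ ζ, ((fnorm ζ * fnorm (-ζ) * mζ m₀ ζ * mζ m₀ (-ζ) : ℝ) : ℂ) *
      FT f ζ * FTc f (-ζ) ∂freqMeasure)
  + ((1 / (4 * (2 * Real.pi) ^ 2) : ℝ) : ℂ) * (∫ ζ₁, ∫ ζ₂, ∫ ζ₃,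
      ((Lam4 m₀ N κ ζ₁ ζ₂ ζ₃ (-(ζ₁ + ζ₂ + ζ₃)) : ℝ) : ℂ) *
        FT f ζ₁ * FTc f ζ₂ * FT f ζ₃ * FTc f (-(ζ₁ + ζ₂ + ζ₃))
      ∂freqMeasure ∂freqMeasure ∂freqMeasure)

/-- The energy functional `E[f] = ∫ ½|∇f|² + ¼|f|⁴`. -/
def energy (f : ℝ × 𝕋 → ℂ) : ℝ :=
  ∫ z, ((1 : ℝ)/2 * (‖dX f z‖ ^ 2 + ‖dY f z‖ ^ 2) + 1/4 * ‖f z‖ ^ 4) ∂spaceMeasure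

end
theorem sqrt_sub_sqrt_sub_one_le_one (D : ℝ) : √D - √(D - 1) ≤ 1 := by
  have h : √D ≤ √(D - 1) + 1 := by
    rw [Real.sqrt_le_left (by positivity)]
    have h₁ : D - 1 ≤ √(D - 1) ^ 2 := by
      rcases le_total 0 (D - 1) with h | h
      · rw [Real.sq_sqrt h]
      · exact h.trans (sq_nonneg _)
    nlinarith [Real.sqrt_nonneg (D - 1)]
  linarith

theorem sqrt_sub_sqrt_sub_one_le_inv_sqrt {D : ℝ} (hD : 0 < D) :
    √D - √(D - 1) ≤ (√D)⁻¹ := by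
  have hs : 0 < √D := Real.sqrt_pos.2 hD
  rw [← one_div, le_div_iff₀ hs]
  have hsq : √D * √D = D := Real.mul_self_sqrt hD.le
  rcases le_total 0 (D - 1) with h | h
  · have h₁ : √(D - 1) * √(D - 1) = D - 1 := Real.mul_self_sqrt h
    have h₂ : √(D - 1) ≤ √D := Real.sqrt_le_sqrt (by linarith)
    nlinarith [Real.sqrt_nonneg (D - 1)]
  · rw [Real.sqrt_eq_zero_of_nonpos h]
    linarith

/-- The set where a translated square lies in `[D - 1, D]` consists of two short intervals. -/
theorem volume_sq_sub_mem_Icc_le (a D : ℝ) :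
    volume {x : ℝ | D - 1 ≤ (x - a) ^ 2 ∧ (x - a) ^ 2 ≤ D}
      ≤ ENNReal.ofReal (2 * (√D - √(D - 1))) := by
  have hmono : √(D - 1) ≤ √D := Real.sqrt_le_sqrt (by linarith)
  have hsub : {x : ℝ | D - 1 ≤ (x - a) ^ 2 ∧ (x - a) ^ 2 ≤ D}
      ⊆ Set.Icc (a + √(D - 1)) (a + √D) ∪ Set.Icc (a - √D) (a - √(D - 1)) := by
    rintro x ⟨h₁, h₂⟩
    have h₃ : √(D - 1) ≤ |x - a| := by
      rw [← Real.sqrt_sq_eq_abs]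
      exact Real.sqrt_le_sqrt h₁
    have h₄ : |x - a| ≤ √D := Real.abs_le_sqrt h₂
    rcases le_total 0 (x - a) with h | h
    · rw [abs_of_nonneg h] at h₃ h₄
      exact Or.inl ⟨by linarith, by linarith⟩
    · rw [abs_of_nonpos h] at h₃ h₄
      exact Or.inr ⟨by linarith, by linarith⟩
  refine (measure_mono hsub).trans ((measure_union_le _ _).trans ?_)
  rw [Real.volume_Icc, Real.volume_Icc, ← ENNReal.ofReal_add (by linarith) (by linarith)]
  exact ENNReal.ofReal_le_ofReal (by linarith)

theorem sum_range_inv_sqrt_le (n : ℕ) :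
    ∑ k ∈ Finset.range n, (√((k + 1 : ℕ) : ℝ))⁻¹ ≤ 2 * √(n : ℝ) := by
  induction n with
  | zero => simp
  | succ n ih =>
    rw [Finset.sum_range_succ]
    have h := sqrt_sub_sqrt_sub_one_le_inv_sqrt (D := ((n + 1 : ℕ) : ℝ)) (by positivity)
    have hs : 0 < √((n + 1 : ℕ) : ℝ) := Real.sqrt_pos.2 (by positivity)
    have hsq : √((n + 1 : ℕ) : ℝ) * √((n + 1 : ℕ) : ℝ) = n + 1 := by
      rw [Real.mul_self_sqrt (by positivity)]
      push_cast
      rfl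
    have hn : √(n : ℝ) * √(n : ℝ) = n := Real.mul_self_sqrt (by positivity)
    have key : (√((n + 1 : ℕ) : ℝ))⁻¹ ≤ 2 * (√((n + 1 : ℕ) : ℝ) - √(n : ℝ)) := by
      rw [← one_div, div_le_iff₀ hs]
      nlinarith [sq_nonneg (√((n + 1 : ℕ) : ℝ) - √(n : ℝ))]
    linarith

/-- A subset of an annulus of unit thickness in squared radius has bounded measure if its rows
are indexed by the natural numbers below their distance to the pole of the annulus. -/
theorem freqMeasure_le_of_rows (a c B : ℝ) (e : ℕ → ℤ) (T : Set (ℝ × ℤ))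
    (hT : ∀ p ∈ T, (B - 1 ≤ (p.1 - a) ^ 2 + ((p.2 : ℝ) - c) ^ 2 ∧
      (p.1 - a) ^ 2 + ((p.2 : ℝ) - c) ^ 2 ≤ B) ∧
      ∃ k : ℕ, p.2 = e k ∧ (k : ℝ) ≤ √B - |(p.2 : ℝ) - c|) :
    freqMeasure T ≤ ENNReal.ofReal 6 := by
  set s := √B with hs
  set n := ⌊s⌋₊ with hn
  have hs0 : 0 ≤ s := Real.sqrt_nonneg B
  let E : ℕ → Set ℝ := fun k => {x | (k : ℝ) ≤ s - |(e k : ℝ) - c| ∧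
    (B - ((e k : ℝ) - c) ^ 2) - 1 ≤ (x - a) ^ 2 ∧ (x - a) ^ 2 ≤ B - ((e k : ℝ) - c) ^ 2}
  let w : ℕ → ℝ := fun k => if k = 0 then 2 else 2 * ((√s)⁻¹ * (√(k : ℝ))⁻¹)
  have hw : ∀ k, 0 ≤ w k := by
    intro k
    dsimp only [w]
    split_ifs <;> positivity
  have hE : ∀ k, volume (E k) ≤ ENNReal.ofReal (w k) := by
    intro k
    by_cases hk : (k : ℝ) ≤ s - |(e k : ℝ) - c|
    · have hsub : E k ⊆ {x : ℝ | (B - ((e k : ℝ) - c) ^ 2) - 1 ≤ (x - a) ^ 2 ∧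
          (x - a) ^ 2 ≤ B - ((e k : ℝ) - c) ^ 2} := fun x hx => hx.2
      refine (measure_mono hsub).trans ((volume_sq_sub_mem_Icc_le _ _).trans
        (ENNReal.ofReal_le_ofReal ?_))
      dsimp only [w]
      split_ifs with h0
      · linarith [sqrt_sub_sqrt_sub_one_le_one (B - ((e k : ℝ) - c) ^ 2)]
      · have hk1 : (1 : ℝ) ≤ k := by exact_mod_cast Nat.one_le_iff_ne_zero.2 h0
        have habs := abs_nonneg ((e k : ℝ) - c)
        have hspos : 0 < s := by linarith
        have hsB : s ^ 2 = B := Real.sq_sqrt (Real.sqrt_pos.1 hspos).le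
        have hD : s * k ≤ B - ((e k : ℝ) - c) ^ 2 := by
          rw [← hsB, ← sq_abs ((e k : ℝ) - c)]
          nlinarith
        have hsk : 0 < s * k := by positivity
        refine mul_le_mul_of_nonneg_left ?_ zero_le_two
        refine (sqrt_sub_sqrt_sub_one_le_inv_sqrt (hsk.trans_le hD)).trans ?_
        rw [← mul_inv, ← Real.sqrt_mul hs0]
        exact inv_anti₀ (Real.sqrt_pos.2 hsk) (Real.sqrt_le_sqrt hD)
    · have hempty : E k = ∅ := Set.eq_empty_of_forall_notMem fun x hx => hk hx.1
      rw [hempty, measure_empty]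
      exact zero_le
  have hcover : T ⊆ ⋃ k ∈ Finset.range (n + 1), E k ×ˢ {e k} := by
    rintro ⟨x, η⟩ hp
    obtain ⟨⟨h₁, h₂⟩, k, hk, hks⟩ := hT _ hp
    dsimp only at h₁ h₂ hk hks
    subst hk
    have hkn : k ≤ n := Nat.le_floor (by linarith [abs_nonneg ((e k : ℝ) - c)])
    refine Set.mem_biUnion (Finset.mem_coe.2 (Finset.mem_range.2 (Nat.lt_succ_of_le hkn))) ?_
    exact ⟨⟨hks, by linarith, by linarith⟩, rfl⟩
  have hsum : ∑ k ∈ Finset.range (n + 1), w k ≤ 6 := by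
    rw [Finset.sum_range_succ']
    have h₁ : ∑ k ∈ Finset.range n, w (k + 1)
        = 2 * (√s)⁻¹ * ∑ k ∈ Finset.range n, (√((k + 1 : ℕ) : ℝ))⁻¹ := by
      rw [Finset.mul_sum]
      refine Finset.sum_congr rfl fun k _ => ?_
      simp only [w, Nat.succ_ne_zero, if_false, mul_assoc]
    have h₂ : (√s)⁻¹ * √(n : ℝ) ≤ 1 := by
      refine (mul_le_mul_of_nonneg_left (Real.sqrt_le_sqrt (Nat.floor_le hs0))
        (by positivity)).trans ?_
      exact inv_mul_le_one
    have h₃ := mul_le_mul_of_nonneg_left (sum_range_inv_sqrt_le n)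
      (show 0 ≤ 2 * (√s)⁻¹ by positivity)
    have h₄ : w 0 = 2 := if_pos rfl
    rw [h₁, h₄]
    linarith
  calc freqMeasure T ≤ ∑ k ∈ Finset.range (n + 1), freqMeasure (E k ×ˢ {e k}) :=
        (measure_mono hcover).trans (measure_biUnion_finset_le _ _)
    _ ≤ ∑ k ∈ Finset.range (n + 1), ENNReal.ofReal (w k) := by
        refine Finset.sum_le_sum fun k _ => ?_
        rw [freqMeasure, Measure.prod_prod, Measure.count_singleton, mul_one]
        exact hE k
    _ = ENNReal.ofReal (∑ k ∈ Finset.range (n + 1), w k) :=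
        (ENNReal.ofReal_sum_of_nonneg fun k _ => hw k).symm
    _ ≤ ENNReal.ofReal 6 := ENNReal.ofReal_le_ofReal hsum

/-- Annuli of unit thickness in squared radius have uniformly bounded measure in `ℝ × ℤ`. -/
theorem freqMeasure_annulus_le (a c B : ℝ) :
    freqMeasure {p : ℝ × ℤ | B - 1 ≤ (p.1 - a) ^ 2 + ((p.2 : ℝ) - c) ^ 2 ∧
      (p.1 - a) ^ 2 + ((p.2 : ℝ) - c) ^ 2 ≤ B} ≤ ENNReal.ofReal 12 := by
  set S := {p : ℝ × ℤ | B - 1 ≤ (p.1 - a) ^ 2 + ((p.2 : ℝ) - c) ^ 2 ∧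
      (p.1 - a) ^ 2 + ((p.2 : ℝ) - c) ^ 2 ≤ B} with hS
  have hy : ∀ p ∈ S, |(p.2 : ℝ) - c| ≤ √B := fun p hp =>
    Real.abs_le_sqrt (by linarith [hp.2, sq_nonneg (p.1 - a)])
  have hupper : freqMeasure (S ∩ {p | c ≤ p.2}) ≤ ENNReal.ofReal 6 := by
    refine freqMeasure_le_of_rows a c B (fun k => ⌊√B + c⌋ - k) _ ?_
    rintro p ⟨hp, hc⟩
    refine ⟨hp, (⌊√B + c⌋ - p.2).toNat, ?_⟩
    have hc' : c ≤ (p.2 : ℝ) := hc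
    have h := hy p hp
    rw [abs_of_nonneg (by linarith)] at h ⊢
    have h0 : p.2 ≤ ⌊√B + c⌋ := Int.le_floor.2 (by linarith)
    have hk : (((⌊√B + c⌋ - p.2).toNat : ℕ) : ℤ) = ⌊√B + c⌋ - p.2 :=
      Int.toNat_of_nonneg (by omega)
    refine ⟨by omega, ?_⟩
    rw [← Int.cast_natCast, hk, Int.cast_sub]
    linarith [Int.floor_le (√B + c)]
  have hlower : freqMeasure (S ∩ {p | (p.2 : ℝ) ≤ c}) ≤ ENNReal.ofReal 6 := by
    refine freqMeasure_le_of_rows a c B (fun k => k - ⌊√B - c⌋) _ ?_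
    rintro p ⟨hp, hc⟩
    refine ⟨hp, (⌊√B - c⌋ + p.2).toNat, ?_⟩
    have hc' : (p.2 : ℝ) ≤ c := hc
    have h := hy p hp
    rw [abs_of_nonpos (by linarith)] at h ⊢
    have h0 : -p.2 ≤ ⌊√B - c⌋ := Int.le_floor.2 (by push_cast; linarith)
    have hk : (((⌊√B - c⌋ + p.2).toNat : ℕ) : ℤ) = ⌊√B - c⌋ + p.2 :=
      Int.toNat_of_nonneg (by omega)
    refine ⟨by omega, ?_⟩
    rw [← Int.cast_natCast, hk, Int.cast_add]
    linarith [Int.floor_le (√B - c)]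
  have hcover : S ⊆ (S ∩ {p | c ≤ p.2}) ∪ (S ∩ {p | (p.2 : ℝ) ≤ c}) := fun p hp =>
    (le_total c (p.2 : ℝ)).imp (fun h => ⟨hp, h⟩) (fun h => ⟨hp, h⟩)
  calc freqMeasure S ≤ ENNReal.ofReal 6 + ENNReal.ofReal 6 :=
        (measure_mono hcover).trans ((measure_union_le _ _).trans (add_le_add hupper hlower))
    _ = ENNReal.ofReal 12 := by
        rw [← ENNReal.ofReal_add (by norm_num) (by norm_num)]
        norm_num

/-- Uniform bound on the measure of the resonant annular intersection set. -/
theorem resonant_set_measure_bound (c₁ c₂ : ℝ) (hc₁ : 0 < c₁) (hc₁₂ : c₁ < c₂) :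
    ∃ C : ℝ≥0∞, C ≠ ⊤ ∧
      ∀ N₀ : ℝ, 1 < N₀ → ∀ τ : ℝ, ∀ ζ : ℝ × ℤ,
        freqMeasure {ζ₁ : ℝ × ℤ |
            c₁ * N₀ ≤ fnorm ζ₁ ∧ fnorm ζ₁ ≤ c₂ * N₀ ∧
            c₁ * N₀ ≤ fnorm (ζ - ζ₁) ∧ fnorm (ζ - ζ₁) ≤ c₂ * N₀ ∧
            |τ - fnorm ζ₁ ^ 2 - fnorm (ζ - ζ₁) ^ 2| ≤ 1} ≤ C := by
  refine ⟨ENNReal.ofReal 12, ENNReal.ofReal_ne_top, fun N₀ _ τ ζ => ?_⟩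
  refine (measure_mono ?_).trans (freqMeasure_annulus_le (ζ.1 / 2) (ζ.2 / 2)
    ((τ + 1 - (ζ.1 ^ 2 + (ζ.2 : ℝ) ^ 2) / 2) / 2))
  rintro ⟨x, η⟩ ⟨-, -, -, -, h⟩
  rw [fnorm, fnorm, Real.sq_sqrt (by positivity), Real.sq_sqrt (by positivity), abs_le] at h
  simp only [Prod.fst_sub, Prod.snd_sub, Int.cast_sub] at h
  constructor <;> dsimp only <;> nlinarith [h.1, h.2]
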